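/- Let p be a prime, q = p^m, and let K be a field of characteristic p containing F_q, complete with respect to a nonarchimedean multiplicative norm |·|. For t ∈ K^* define in PGL(2,K) the elements ε_u (class of [[1,u],[0,1]]) for u ∈ F_q, τ_t (class of [[0,t],[1,0]]), and ε'_{u,t} = τ_t ε_u τ_t, and let N₁(t) ≤ PGL(2,K) be the subgroup generated by {ε_u : u ∈ F_q} ∪ {ε'_{v,t} : v ∈ F_q}. Let t₁, t₂ ∈ K with 0 < |t₁| < 1 and 0 < |t₂| < 1. Then N₁(t₁) and N₁(t₂) are conjugate subgroups of PGL(2,K) if and only if t₁ = ζ t₂ for some nonzero ζ ∈ F_q. -/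

import Mathlib

open scoped Classical

/-- The projective general linear group `PGL(2,K)`: the quotient of `GL(2,K)` by its center
(the nonzero scalar matrices). -/
abbrev PGL2 (K : Type*) [Field K] :=
  Matrix.GeneralLinearGroup (Fin 2) K ⧸
    Subgroup.center (Matrix.GeneralLinearGroup (Fin 2) K)

/-- The class in `PGL(2,K)` of a 2×2 matrix with nonzero determinant. -/
noncomputable def pgl2 {K : Type*} [Field K] (A : Matrix (Fin 2) (Fin 2) K)
    (h : A.det ≠ 0) : PGL2 K :=
  QuotientGroup.mk (Matrix.GeneralLinearGroup.mkOfDetNeZero A h)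

/-- `ε_c`: the class in `PGL(2,K)` of the matrix `[[1, c], [0, 1]]`. -/
noncomputable def eps {K : Type*} [Field K] (c : K) : PGL2 K :=
  pgl2 !![1, c; 0, 1] (by simp [Matrix.det_fin_two_of])

/-- `τ_t`: the class in `PGL(2,K)` of the matrix `[[0, t], [1, 0]]` (junk value `1` when
`t = 0`). -/
noncomputable def tau {K : Type*} [Field K] (t : K) : PGL2 K :=
  if h : t = 0 then 1 else pgl2 !![0, t; 1, 0] (by simp [Matrix.det_fin_two_of, h])

/-- `ε'_{c,t} = τ_t ε_c τ_t`: the class in `PGL(2,K)` of the matrix `[[t, 0], [c, t]]`. -/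
noncomputable def eps' {K : Type*} [Field K] (c t : K) : PGL2 K :=
  tau t * eps c * tau t

/-- `δ_{u,v,t}`: the commutator of `ε_u` and `ε'_{v,t}` in `PGL(2,K)`. -/
noncomputable def deltaC {K : Type*} [Field K] (u v t : K) : PGL2 K :=
  eps u * eps' v t * (eps u)⁻¹ * (eps' v t)⁻¹

/-- `μ_a`: the class in `PGL(2,K)` of the matrix `[[a, 0], [0, 1]]` (junk value `1` when
`a = 0`). -/
noncomputable def muA {K : Type*} [Field K] (a : K) : PGL2 K :=
  if h : a = 0 then 1 else pgl2 !![a, 0; 0, 1] (by simp [Matrix.det_fin_two_of, h])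

/-- `Γ(t)`: the subgroup of `PGL(2,K)` generated by the commutators `δ_{u,v,t}` for
`u, v ∈ F_q` (embedded in `K` via `i`); the Schottky group of the
Artin–Schreier–Mumford curve. -/
noncomputable def GammaASM {K : Type*} [Field K] {F : Type*} [Field F] [Fintype F]
    (i : F →+* K) (t : K) : Subgroup (PGL2 K) :=
  Subgroup.closure {g | ∃ u v : F, g = deltaC (i u) (i v) t}

/-- `N₁(t)`: the subgroup of `PGL(2,K)` generated by all `ε_u` and `ε'_{v,t}` for
`u, v ∈ F_q`. -/
noncomputable def N1ASM {K : Type*} [Field K] {F : Type*} [Field F] [Fintype F]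
    (i : F →+* K) (t : K) : Subgroup (PGL2 K) :=
  Subgroup.closure ({g | ∃ u : F, g = eps (i u)} ∪ {g | ∃ v : F, g = eps' (i v) t})

/-- `N₀(t)`: the subgroup of `PGL(2,K)` generated by `Γ(t)` together with the `ε'_{u,t}`. -/
noncomputable def N0ASM {K : Type*} [Field K] {F : Type*} [Field F] [Fintype F]
    (i : F →+* K) (t : K) : Subgroup (PGL2 K) :=
  GammaASM i t ⊔ Subgroup.closure {g | ∃ u : F, g = eps' (i u) t}

/-- `N(t)`: the subgroup of `PGL(2,K)` generated by the `ε_u`, `τ_t` and the `μ_a` for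
`a ∈ F_q^*`; the normalizer of the Schottky group `Γ(t)`. -/
noncomputable def NASM {K : Type*} [Field K] {F : Type*} [Field F] [Fintype F]
    (i : F →+* K) (t : K) : Subgroup (PGL2 K) :=
  Subgroup.closure
    ({g | ∃ u : F, g = eps (i u)} ∪ {tau t} ∪ {g | ∃ a : F, a ≠ 0 ∧ g = muA (i a)})

namespace ASMaux

open Matrix

/-- `ε_u · ε'_v` normalized to determinant one. -/
noncomputable def X {K : Type*} [Field K] {F : Type*} [Field F] (i : F →+* K) (t : K)
    (x : F × F) : Matrix (Fin 2) (Fin 2) K :=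
  !![1 + i x.1 * (i x.2 / t), i x.1; i x.2 / t, 1]

/-- Product of a word. -/
noncomputable def W {K : Type*} [Field K] {F : Type*} [Field F] (i : F →+* K) (t : K)
    (l : List (F × F)) : Matrix (Fin 2) (Fin 2) K :=
  (l.map (X i t)).prod

section alg
variable {K : Type*} [Field K] {F : Type*} [Field F] (i : F →+* K) (t : K)

lemma W_nil : W i t [] = 1 := by simp [W]

lemma W_cons (x : F × F) (l) : W i t (x :: l) = X i t x * W i t l := by simp [W]

lemma W_append (l l') : W i t (l ++ l') = W i t l * W i t l' := by simp [W]

lemma W_single (x : F × F) : W i t [x] = X i t x := by simp [W]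

lemma det_X (x : F × F) : (X i t x).det = 1 := by
  simp [X, Matrix.det_fin_two_of]

lemma det_W (l) : (W i t l).det = 1 := by
  induction l with
  | nil => simp [W_nil]
  | cons x l ih => rw [W_cons, Matrix.det_mul, ih, det_X, one_mul]

lemma merge_left (u u' v' : F) : X i t (u, 0) * X i t (u', v') = X i t (u + u', v') := by
  ext a b; fin_cases a <;> fin_cases b <;> simp [X, Matrix.mul_apply, Fin.sum_univ_two] <;> ring

lemma merge_right (u v v' : F) : X i t (u, v) * X i t (0, v') = X i t (u, v + v') := by
  ext a b; fin_cases a <;> fin_cases b <;> simp [X, Matrix.mul_apply, Fin.sum_univ_two] <;> ring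

lemma trace_X (x : F × F) : (X i t x).trace = 2 + i (x.1 * x.2) / t := by
  simp [X, Matrix.trace_fin_two]; ring

lemma trace_X_zero (x : F × F) (h : x.1 = 0 ∨ x.2 = 0) : (X i t x).trace = 2 := by
  rw [trace_X]; rcases h with h | h <;> simp [h]

lemma mk_eq (A B : GL (Fin 2) K) (c : K) (h : A.val = c • B.val) :
    (QuotientGroup.mk A : PGL2 K) = QuotientGroup.mk B := by
  symm
  rw [QuotientGroup.eq, Matrix.GeneralLinearGroup.mem_center_iff_val_mem_range_scalar]
  refine ⟨c, ?_⟩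
  rw [Units.val_mul, h, Matrix.mul_smul, Units.inv_mul]
  ext a b; simp [Matrix.scalar_apply, Matrix.diagonal_apply, Matrix.one_apply]

lemma of_mk_eq (A B : GL (Fin 2) K)
    (h : (QuotientGroup.mk A : PGL2 K) = QuotientGroup.mk B) : ∃ c : K, A.val = c • B.val := by
  symm at h
  rw [QuotientGroup.eq, Matrix.GeneralLinearGroup.mem_center_iff_val_mem_range_scalar] at h
  obtain ⟨c, hc⟩ := h
  refine ⟨c, ?_⟩
  have : A.val = B.val * (B⁻¹ * A).val := by rw [← Units.val_mul, mul_inv_cancel_left]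
  rw [this, ← hc, Matrix.scalar_apply, ← Matrix.smul_one_eq_diagonal, Matrix.mul_smul, mul_one]

/-- the word as a group element -/
noncomputable def GW (l : List (F × F)) : GL (Fin 2) K :=
  Matrix.GeneralLinearGroup.mkOfDetNeZero (W i t l) (by rw [det_W]; exact one_ne_zero)

lemma GW_val (l) : (GW i t l).val = W i t l := rfl

lemma GW_append (l l') : GW i t (l ++ l') = GW i t l * GW i t l' := by
  apply Units.ext
  rw [Units.val_mul, GW_val, GW_val, GW_val, W_append]

lemma eps_eq (u : F) : eps (i u) = (QuotientGroup.mk (GW i t [(u, 0)]) : PGL2 K) := by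
  unfold eps pgl2
  congr 1
  apply Units.ext
  rw [GW_val, W_single]
  simp [X, Matrix.GeneralLinearGroup.mkOfDetNeZero, Matrix.GeneralLinearGroup.mk',
    Matrix.unitOfDetInvertible]

lemma eps'_eq (ht : t ≠ 0) (v : F) :
    eps' (i v) t = (QuotientGroup.mk (GW i t [(0, v)]) : PGL2 K) := by
  unfold eps' eps tau pgl2
  rw [dif_neg ht, ← QuotientGroup.mk_mul, ← QuotientGroup.mk_mul]
  apply mk_eq _ _ t
  rw [GW_val, W_single]
  simp only [Units.val_mul, X, Matrix.GeneralLinearGroup.mkOfDetNeZero,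
    Matrix.GeneralLinearGroup.mk', Matrix.unitOfDetInvertible]
  ext a b; fin_cases a <;> fin_cases b <;> simp [Matrix.mul_apply, Fin.sum_univ_two]
  field_simp

lemma GW_inv_left (u : F) : (GW i t [(u, 0)])⁻¹ = GW i t [(-u, 0)] := by
  rw [inv_eq_iff_mul_eq_one, ← GW_append]
  apply Units.ext
  rw [GW_val]
  simp only [List.cons_append, List.nil_append, W_cons, W_nil, mul_one, merge_left]
  ext a b; fin_cases a <;> fin_cases b <;> simp [X]

lemma GW_inv_right (u : F) : (GW i t [(0, u)])⁻¹ = GW i t [(0, -u)] := by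
  rw [inv_eq_iff_mul_eq_one, ← GW_append]
  apply Units.ext
  rw [GW_val]
  simp only [List.cons_append, List.nil_append, W_cons, W_nil, mul_one, merge_right]
  ext a b; fin_cases a <;> fin_cases b <;> simp [X]

lemma rep [Fintype F] (ht : t ≠ 0) (g : PGL2 K) (hg : g ∈ N1ASM i t) :
    ∃ l, g = QuotientGroup.mk (GW i t l) := by
  unfold N1ASM at hg
  induction hg using Subgroup.closure_induction_right with
  | one =>
    refine ⟨[], ?_⟩
    have : GW i t [] = 1 := by apply Units.ext; rw [GW_val, W_nil]; rfl
    rw [this]; rfl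
  | mul_right x hx y hy ih =>
    obtain ⟨l, rfl⟩ := ih
    rcases hy with ⟨u, rfl⟩ | ⟨v, rfl⟩
    · exact ⟨l ++ [(u, 0)], by rw [eps_eq i t, GW_append]; rfl⟩
    · exact ⟨l ++ [(0, v)], by rw [eps'_eq i t ht, GW_append]; rfl⟩
  | mul_inv_cancel x hx y hy ih =>
    obtain ⟨l, rfl⟩ := ih
    rcases hy with ⟨u, rfl⟩ | ⟨v, rfl⟩
    · exact ⟨l ++ [(-u, 0)], by
        rw [eps_eq i t, GW_append, ← QuotientGroup.mk_inv, GW_inv_left]; rfl⟩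
    · exact ⟨l ++ [(0, -v)], by
        rw [eps'_eq i t ht, GW_append, ← QuotientGroup.mk_inv, GW_inv_right]; rfl⟩

end alg

section norm
variable {K : Type*} [NormedField K] {F : Type*} [Field F] [Fintype F]
  (i : F →+* K) (t : K)

lemma norm_i (u : F) (hu : u ≠ 0) : ‖i u‖ = 1 := by
  have h : (i u) ^ (Fintype.card F - 1) = 1 := by
    rw [← map_pow, FiniteField.pow_card_sub_one_eq_one u hu, map_one]
  have h2 : ‖i u‖ ^ (Fintype.card F - 1) = 1 := by rw [← norm_pow, h, norm_one]
  have : Fintype.card F - 1 ≠ 0 := by have := Fintype.one_lt_card (α := F); omega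
  exact (pow_eq_one_iff_of_nonneg (norm_nonneg _) this).1 h2

variable [IsUltrametricDist K]

lemma add_lt {a b : K} {c : ℝ} (ha : ‖a‖ < c) (hb : ‖b‖ < c) : ‖a + b‖ < c :=
  (IsUltrametricDist.norm_add_le_max a b).trans_lt (max_lt ha hb)

lemma add_le {a b : K} {c : ℝ} (ha : ‖a‖ ≤ c) (hb : ‖b‖ ≤ c) : ‖a + b‖ ≤ c :=
  (IsUltrametricDist.norm_add_le_max a b).trans (max_le ha hb)

lemma add_eq {a b : K} {c : ℝ} (ha : ‖a‖ = c) (hb : ‖b‖ < c) : ‖a + b‖ = c := by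
  apply le_antisymm (add_le ha.le hb.le)
  by_contra! h
  have : ‖(a + b) + (-b)‖ < c := add_lt h (by rwa [norm_neg])
  rw [add_neg_cancel_right] at this
  linarith

lemma norm_two : ‖(2 : K)‖ ≤ 1 := by
  rw [← one_add_one_eq_two]; exact add_le norm_one.le norm_one.le

lemma norm_top (h0 : 0 < ‖t‖) (h1 : ‖t‖ < 1) (u v : F) (hu : u ≠ 0) (hv : v ≠ 0) :
    ‖1 + i u * (i v / t)‖ = ‖t‖⁻¹ := by
  rw [add_comm]
  apply add_eq
  · rw [norm_mul, norm_div, norm_i i u hu, norm_i i v hv]; simp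
  · rw [norm_one]; exact (one_lt_inv₀ h0).2 h1

lemma estimate (h0 : 0 < ‖t‖) (h1 : ‖t‖ < 1) (l : List (F × F)) (hl : l ≠ [])
    (h : ∀ x ∈ l, x.1 ≠ 0 ∧ x.2 ≠ 0) :
    ‖W i t l 0 0‖ = (‖t‖⁻¹) ^ l.length ∧ ‖W i t l 0 1‖ < (‖t‖⁻¹) ^ l.length ∧
    ‖W i t l 1 0‖ ≤ (‖t‖⁻¹) ^ l.length ∧ ‖W i t l 1 1‖ < (‖t‖⁻¹) ^ l.length := by
  have hr : 1 < ‖t‖⁻¹ := (one_lt_inv₀ h0).2 h1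
  induction l with
  | nil => exact absurd rfl hl
  | cons x l ih =>
    obtain ⟨u, v⟩ := x
    obtain ⟨hu, hv⟩ := h (u, v) (by simp)
    simp only at hu hv
    have htop := norm_top i t h0 h1 u v hu hv
    have hu1 := norm_i i u hu
    have hw : ‖i v / t‖ = ‖t‖⁻¹ := by rw [norm_div, norm_i i v hv, one_div]
    by_cases hl' : l = []
    · subst hl'
      rw [W_single]
      simp [X, htop, hu1, hw, hr, -norm_div]
    · obtain ⟨e1, e2, e3, e4⟩ := ih hl' (fun x hx => h x (by simp [hx]))
      rw [W_cons, List.length_cons, pow_succ']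
      generalize ‖t‖⁻¹ = r at *
      generalize r ^ l.length = R at *
      have hR : 0 < R := (norm_nonneg _).trans_lt e2
      have hRr : R < r * R := by nlinarith
      simp only [Matrix.mul_apply, Fin.sum_univ_two, X, Matrix.of_apply, Matrix.cons_val_zero,
        Matrix.cons_val_one]
      refine ⟨?_, ?_, ?_, ?_⟩
      · apply add_eq
        · rw [norm_mul, htop, e1]
        · rw [norm_mul, hu1, one_mul]; linarith
      · apply add_lt
        · rw [norm_mul, htop]; nlinarith
        · rw [norm_mul, hu1, one_mul]; linarith
      · apply add_le
        · rw [norm_mul, hw, e1]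
        · rw [norm_mul, norm_one, one_mul]; linarith
      · apply add_lt
        · rw [norm_mul, hw]; nlinarith
        · rw [norm_mul, norm_one, one_mul]; linarith

lemma trace_claim (h0 : 0 < ‖t‖) (h1 : ‖t‖ < 1) (n : ℕ) : ∀ (l : List (F × F)), l.length = n →
    (W i t l).trace = 2 ∨ (∃ c : F, c ≠ 0 ∧ (W i t l).trace = 2 + i c / t) ∨
      (‖t‖⁻¹) ^ 2 ≤ ‖(W i t l).trace‖ := by
  induction n using Nat.strong_induction_on with
  | _ n ih =>
  intro l hn
  by_cases hl : l = []
  · left; subst hl; rw [W_nil]; simp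
  by_cases h : ∀ x ∈ l, x.1 ≠ 0 ∧ x.2 ≠ 0
  · obtain ⟨e1, -, -, e4⟩ := estimate i t h0 h1 l hl h
    by_cases h2 : 2 ≤ l.length
    · right; right
      rw [Matrix.trace_fin_two, add_eq e1 e4]
      exact pow_le_pow_right₀ ((one_lt_inv₀ h0).2 h1).le h2
    · right; left
      have : l.length = 1 := by
        have := List.length_pos_of_ne_nil hl
        omega
      obtain ⟨x, rfl⟩ := List.length_eq_one_iff.1 this
      obtain ⟨hu, hv⟩ := h x (by simp)
      exact ⟨x.1 * x.2, mul_ne_zero hu hv, by rw [W_single, trace_X]⟩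
  · push Not at h
    obtain ⟨⟨u, v⟩, hx, hx2⟩ := h
    obtain ⟨l1, l2, rfl⟩ := List.append_of_mem hx
    by_cases hu : u = 0
    · subst hu
      have ht : (W i t (l1 ++ (0, v) :: l2)).trace = (W i t ((l2 ++ l1) ++ [(0, v)])).trace := by
        rw [W_append, W_cons, W_append, W_append, W_single, ← mul_assoc, Matrix.trace_mul_comm,
          mul_assoc]
      rw [ht]
      have hlen : (l2 ++ l1).length + 1 = n := by rw [← hn]; simp; omega
      rcases List.eq_nil_or_concat (l2 ++ l1) with e | ⟨l3, ⟨u', v'⟩, e⟩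
      · left
        rw [e, List.nil_append, W_single, trace_X_zero _ _ _ (Or.inl rfl)]
      · rw [List.concat_eq_append] at e
        rw [e] at hlen ⊢
        have : W i t (l3 ++ [(u', v')] ++ [(0, v)]) = W i t (l3 ++ [(u', v' + v)]) := by
          rw [W_append, W_append, W_append, W_single, W_single, W_single, mul_assoc, merge_right]
        rw [this]
        exact ih (n - 1) (by omega) _ (by simp at hlen ⊢; omega)
    · have hv : v = 0 := hx2 hu
      subst hv
      have ht : (W i t (l1 ++ (u, 0) :: l2)).trace = (W i t ((u, 0) :: (l2 ++ l1))).trace := by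
        rw [W_append, W_cons, W_cons, W_append, Matrix.trace_mul_comm, mul_assoc]
      rw [ht]
      have hlen : (l2 ++ l1).length + 1 = n := by rw [← hn]; simp; omega
      rcases e : l2 ++ l1 with _ | ⟨⟨u', v'⟩, l3⟩
      · left
        rw [W_single, trace_X_zero _ _ _ (Or.inr rfl)]
      · rw [e] at hlen
        have : W i t ((u, 0) :: (u', v') :: l3) = W i t ((u + u', v') :: l3) := by
          rw [W_cons, W_cons, W_cons, ← mul_assoc, merge_left]
        rw [this]
        exact ih (n - 1) (by omega) _ (by simp at hlen ⊢; omega)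

/-- Elements of trace `2` in the first group are sent to words, with no sign. -/
lemma no_sign (h0 : 0 < ‖t‖) (h1 : ‖t‖ < 1) (A : GL (Fin 2) K) (hA : A.val.trace = 2)
    (hd : A.val.det = 1) (l : List (F × F))
    (h : (QuotientGroup.mk A : PGL2 K) = QuotientGroup.mk (GW i t l)) : A.val = W i t l := by
  have hr : 1 < ‖t‖⁻¹ := (one_lt_inv₀ h0).2 h1
  obtain ⟨c, hc⟩ := of_mk_eq _ _ h
  rw [GW_val] at hc
  have hc2 : c ^ 2 = 1 := by
    have := congrArg Matrix.det hc
    rw [Matrix.det_smul, hd, det_W] at this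
    simpa using this.symm
  rcases (mul_self_eq_one_iff.1 ((sq c).symm.trans hc2)) with rfl | rfl
  · rw [hc, one_smul]
  · have htr : (W i t l).trace = -2 := by
      have := congrArg Matrix.trace hc
      rw [hA, Matrix.trace_smul] at this
      rw [this]; simp
    have hn : ‖(W i t l).trace‖ ≤ 1 := by rw [htr, norm_neg]; exact norm_two
    rcases trace_claim i t h0 h1 _ l rfl with h2 | ⟨d, hd, h2⟩ | h2
    · have h4 : (2 : K) = -2 := by rw [← htr, h2]
      have h5 : (2 : K) * 2 = 0 := by linear_combination h4
      have h6 : (2 : K) = 0 := by simpa using h5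
      have h7 : (-1 : K) = 1 := by linear_combination -h6
      rw [hc, h7, one_smul]
    · have : ‖i d / t + 2‖ = ‖t‖⁻¹ := by
        apply add_eq
        · rw [norm_div, norm_i i d hd, one_div]
        · exact norm_two.trans_lt hr
      rw [h2, add_comm, this] at hn
      linarith
    · nlinarith

lemma key (t₁ t₂ : K) (h₁0 : 0 < ‖t₁‖) (h₂0 : 0 < ‖t₂‖) (h₂1 : ‖t₂‖ < 1)
    (h₁1 : ‖t₁‖ < 1) (g : PGL2 K) (h : ∀ x ∈ N1ASM i t₁, g * x * g⁻¹ ∈ N1ASM i t₂) :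
    (∃ ζ : F, ζ ≠ 0 ∧ t₁ = i ζ * t₂) ∨ ‖t₁‖ ≤ ‖t₂‖ ^ 2 := by
  have ht₁ : t₁ ≠ 0 := norm_pos_iff.1 h₁0
  have ht₂ : t₂ ≠ 0 := norm_pos_iff.1 h₂0
  obtain ⟨P, rfl⟩ := QuotientGroup.mk_surjective g
  have main : ∀ x : F × F, (x.1 = 0 ∨ x.2 = 0) →
      (QuotientGroup.mk (GW i t₁ [x]) : PGL2 K) ∈ N1ASM i t₁ →
      ∃ l, (P * GW i t₁ [x] * P⁻¹).val = W i t₂ l := by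
    intro x hx hm
    obtain ⟨l, hl⟩ := rep i t₂ ht₂ _ (h _ hm)
    refine ⟨l, no_sign i t₂ h₂0 h₂1 _ ?_ ?_ l ?_⟩
    · rw [Units.val_mul, Matrix.trace_mul_comm, ← Units.val_mul, inv_mul_cancel_left, GW_val,
        W_single, trace_X_zero _ _ _ hx]
    · rw [Units.val_mul, Matrix.det_mul_comm, ← Units.val_mul, inv_mul_cancel_left, GW_val,
        det_W]
    · rw [← hl]; rfl
  obtain ⟨l1, e1⟩ := main (1, 0) (Or.inr rfl)
    (by rw [← eps_eq]; exact Subgroup.subset_closure (Or.inl ⟨1, rfl⟩))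
  obtain ⟨l2, e2⟩ := main (0, 1) (Or.inl rfl)
    (by rw [← eps'_eq i t₁ ht₁]; exact Subgroup.subset_closure (Or.inr ⟨1, rfl⟩))
  have htr : (W i t₂ (l1 ++ l2)).trace = 2 + 1 / t₁ := by
    rw [W_append, ← e1, ← e2, ← Units.val_mul]
    have : P * GW i t₁ [(1, 0)] * P⁻¹ * (P * GW i t₁ [(0, 1)] * P⁻¹)
        = P * (GW i t₁ [(1, 0)] * GW i t₁ [(0, 1)]) * P⁻¹ := by group
    rw [this, Units.val_mul, Matrix.trace_mul_comm, ← Units.val_mul, inv_mul_cancel_left,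
      Units.val_mul, GW_val, GW_val, W_single, W_single, merge_left, trace_X]
    simp
  rcases trace_claim i t₂ h₂0 h₂1 _ (l1 ++ l2) rfl with h2 | ⟨c, hc, h2⟩ | h2
  · rw [htr] at h2
    have : 1 / t₁ = 0 := by linear_combination h2
    simp [ht₁] at this
  · left
    rw [htr] at h2
    have h3 : 1 / t₁ = i c / t₂ := by linear_combination h2
    have hic : i c ≠ 0 := by simpa using hc
    refine ⟨c⁻¹, inv_ne_zero hc, ?_⟩
    rw [map_inv₀]
    field_simp at h3 ⊢
    linear_combination -h3
  · right
    have : ‖1 / t₁ + 2‖ = ‖t₁‖⁻¹ := by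
      apply add_eq
      · simp
      · exact norm_two.trans_lt ((one_lt_inv₀ h₁0).2 h₁1)
    rw [htr, add_comm, this, inv_pow] at h2
    exact (inv_le_inv₀ (by positivity) h₁0).1 h2

end norm

section easy
variable {K : Type*} [Field K] {F : Type*} [Field F] [Fintype F] (i : F →+* K)

lemma N1_le (t : K) (ht : t ≠ 0) (ζ : F) (hz : ζ ≠ 0) : N1ASM i (i ζ * t) ≤ N1ASM i t := by
  have hi : i ζ ≠ 0 := by simpa using hz
  unfold N1ASM
  rw [Subgroup.closure_le]
  rintro x (⟨u, rfl⟩ | ⟨v, rfl⟩)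
  · exact Subgroup.subset_closure (Or.inl ⟨u, rfl⟩)
  · refine Subgroup.subset_closure (Or.inr ⟨v / ζ, ?_⟩)
    rw [eps'_eq i _ (mul_ne_zero hi ht), eps'_eq i _ ht]
    congr 1
    apply Units.ext
    rw [GW_val, GW_val, W_single, W_single]
    simp [X, div_div]

end easy

end ASMaux

/-- The groups `N₁(t₁)` and `N₁(t₂)` (generated by the `ε_u` and `ε'_{v,tᵢ}`), with
`0 < |t₁| < 1` and `0 < |t₂| < 1`, are conjugate subgroups of `PGL(2,K)` if and only if
`t₁ = ζ t₂` for some nonzero `ζ ∈ F_q`. -/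
theorem asm_N1_conjugate_iff
    {p m : ℕ} (hp : p.Prime) (hm : 0 < m) {q : ℕ} (hq : q = p ^ m)
    {K : Type*} [NormedField K] [CompleteSpace K] [IsUltrametricDist K] [CharP K p]
    {F : Type*} [Field F] [Fintype F] (hF : Fintype.card F = q) (i : F →+* K)
    (t₁ t₂ : K) (h₁0 : 0 < ‖t₁‖) (h₁1 : ‖t₁‖ < 1) (h₂0 : 0 < ‖t₂‖) (h₂1 : ‖t₂‖ < 1) :
    (∃ g : PGL2 K,
        Subgroup.map (MulAut.conj g).toMonoidHom (N1ASM i t₁) = N1ASM i t₂)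
      ↔ ∃ ζ : F, ζ ≠ 0 ∧ t₁ = i ζ * t₂ := by
  constructor
  · rintro ⟨g, hg⟩
    have hA : ∀ x ∈ N1ASM i t₁, g * x * g⁻¹ ∈ N1ASM i t₂ := by
      intro x hx
      rw [← hg]
      exact ⟨x, hx, rfl⟩
    have hB : ∀ x ∈ N1ASM i t₂, g⁻¹ * x * g⁻¹⁻¹ ∈ N1ASM i t₁ := by
      intro x hx
      rw [← hg] at hx
      obtain ⟨y, hy, rfl⟩ := hx
      have : g⁻¹ * (MulAut.conj g).toMonoidHom y * g⁻¹⁻¹ = y := by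
        simp [mul_assoc]
      rw [this]; exact hy
    rcases ASMaux.key i t₁ t₂ h₁0 h₂0 h₂1 h₁1 g hA with h | h
    · exact h
    rcases ASMaux.key i t₂ t₁ h₂0 h₁0 h₁1 h₂1 g⁻¹ hB with ⟨ζ, hz, h'⟩ | h'
    · refine ⟨ζ⁻¹, inv_ne_zero hz, ?_⟩
      have hi : i ζ ≠ 0 := by simpa using hz
      rw [h', map_inv₀, inv_mul_cancel_left₀ hi]
    · nlinarith
  · rintro ⟨ζ, hz, rfl⟩
    have ht : t₂ ≠ 0 := norm_pos_iff.1 h₂0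
    have hi : i ζ ≠ 0 := by simpa using hz
    refine ⟨1, ?_⟩
    have : N1ASM i (i ζ * t₂) = N1ASM i t₂ := by
      apply le_antisymm (ASMaux.N1_le i t₂ ht ζ hz)
      have h := ASMaux.N1_le i (i ζ * t₂) (mul_ne_zero hi ht) ζ⁻¹ (inv_ne_zero hz)
      rwa [map_inv₀, inv_mul_cancel_left₀ hi] at h
    rw [this]
    ext x
    simp [Subgroup.mem_map]
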